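/- arXiv:0711.1299 — 5 statements merged into one kernel-verified Lean document; each statement's English description precedes it below -/
import Mathlib

section
/- Canonical form of null two-forms (Lemma 2 of the paper): Let F be a nonzero null two-form on Minkowski space, i.e. F ≠ 0, I₁(F) = 0 and I₂(F) = 0. Then there exist a null vector l ≠ 0 and a spacelike vector w with η(l,w) = 0 such that F(u,v) = η(l,u)·η(w,v) − η(w,u)·η(l,v) for all u,v ∈ ℝ⁴ (i.e. F_{μν} = l_μ w_ν − l_ν w_μ with indices lowered by η), and moreover Σ_ν F_{μν} l^ν = 0 for all μ. -/
noncomputable section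

/-- The Minkowski metric η = diag(-1,1,1,1) on ℝ⁴. -/
def eta : Matrix (Fin 4) (Fin 4) ℝ :=
  fun μ ν => if μ = ν then (if μ = 0 then -1 else 1) else 0

/-- The Minkowski bilinear form η(u,v) = -u⁰v⁰ + u¹v¹ + u²v² + u³v³. -/
def etaB (u v : Fin 4 → ℝ) : ℝ := ∑ μ, ∑ ν, eta μ ν * u μ * v ν

/-- Indices raised with η: F^{μν} = Σ η^{μα} η^{νβ} F_{αβ} (η is its own inverse). -/
def Fup (F : Matrix (Fin 4) (Fin 4) ℝ) : Matrix (Fin 4) (Fin 4) ℝ :=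
  fun μ ν => ∑ α, ∑ β, eta μ α * eta ν β * F α β

/-- First invariant I₁(F) = Σ F_{μν} F^{μν}. -/
def I1 (F : Matrix (Fin 4) (Fin 4) ℝ) : ℝ := ∑ μ, ∑ ν, F μ ν * Fup F μ ν

/-- The Levi-Civita symbol on four indices, with ε₀₁₂₃ = 1. -/
def eps (a b c d : Fin 4) : ℝ :=
  ((((b.val : ℤ) - (a.val : ℤ)).sign * ((c.val : ℤ) - (a.val : ℤ)).sign *
    ((d.val : ℤ) - (a.val : ℤ)).sign * ((c.val : ℤ) - (b.val : ℤ)).sign *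
    ((d.val : ℤ) - (b.val : ℤ)).sign * ((d.val : ℤ) - (c.val : ℤ)).sign : ℤ) : ℝ)

/-- Hodge dual F*_{μν} = ½ Σ ε_{μναβ} F^{αβ}. -/
def Fstar (F : Matrix (Fin 4) (Fin 4) ℝ) : Matrix (Fin 4) (Fin 4) ℝ :=
  fun μ ν => (1 / 2) * ∑ α, ∑ β, eps μ ν α β * Fup F α β

/-- Second invariant I₂(F) = Σ F*_{μν} F^{μν}. -/
def I2 (F : Matrix (Fin 4) (Fin 4) ℝ) : ℝ := ∑ μ, ∑ ν, Fstar F μ ν * Fup F μ ν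

/-- The first invariant in terms of the electric and magnetic components. -/
lemma I1_eq (F : Matrix (Fin 4) (Fin 4) ℝ) (hAnti : ∀ μ ν, F μ ν = - F ν μ) :
    I1 F = 2 * (F 2 3 ^ 2 + F 3 1 ^ 2 + F 1 2 ^ 2 - (F 0 1 ^ 2 + F 0 2 ^ 2 + F 0 3 ^ 2)) := by
  have hdiag (μ : Fin 4) : F μ μ = 0 := by linarith [hAnti μ μ]
  simp [I1, Fup, eta, Fin.sum_univ_four, hdiag]
  rw [hAnti 1 0, hAnti 2 0, hAnti 3 0, hAnti 2 1, hAnti 3 2, hAnti 1 3]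
  ring

/-- The second invariant in terms of the electric and magnetic components. -/
lemma I2_eq (F : Matrix (Fin 4) (Fin 4) ℝ) (hAnti : ∀ μ ν, F μ ν = - F ν μ) :
    I2 F = -4 * (F 0 1 * F 2 3 + F 0 2 * F 3 1 + F 0 3 * F 1 2) := by
  have hdiag (μ : Fin 4) : F μ μ = 0 := by linarith [hAnti μ μ]
  have hs2 : Int.sign 2 = 1 := rfl
  have hs3 : Int.sign 3 = 1 := rfl
  simp [I2, Fstar, Fup, eta, eps, Fin.sum_univ_four, hdiag, hs2, hs3]
  rw [hAnti 1 0, hAnti 2 0, hAnti 3 0, hAnti 2 1, hAnti 3 2, hAnti 1 3]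
  ring

/-- The Minkowski bilinear form in coordinates. -/
lemma etaB_eq (u v : Fin 4 → ℝ) :
    etaB u v = -(u 0 * v 0) + u 1 * v 1 + u 2 * v 2 + u 3 * v 3 := by
  simp [etaB, eta, Fin.sum_univ_four]

/-- Canonical form of a nonzero null two-form on Minkowski space:
F_{μν} = l_μ w_ν − l_ν w_μ with l null, w spacelike, η(l,w) = 0, and F_{μν} l^ν = 0. -/
theorem canonical_form_of_null_two_form
    (F : Matrix (Fin 4) (Fin 4) ℝ)
    (hAnti : ∀ μ ν, F μ ν = - F ν μ)
    (hne : F ≠ 0)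
    (h1 : I1 F = 0) (h2 : I2 F = 0) :
    ∃ l w : Fin 4 → ℝ,
      l ≠ 0 ∧ etaB l l = 0 ∧ 0 < etaB w w ∧ etaB l w = 0 ∧
      (∀ u v : Fin 4 → ℝ,
        (∑ μ, ∑ ν, F μ ν * u μ * v ν) = etaB l u * etaB w v - etaB w u * etaB l v) ∧
      (∀ μ, (∑ ν, F μ ν * l ν) = 0) := by
  have hdiag (μ : Fin 4) : F μ μ = 0 := by linarith [hAnti μ μ]
  have h10 := hAnti 1 0
  have h20 := hAnti 2 0
  have h30 := hAnti 3 0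
  have h21 := hAnti 2 1
  have h32 := hAnti 3 2
  have h13 := hAnti 1 3
  rw [I1_eq F hAnti] at h1
  rw [I2_eq F hAnti] at h2
  obtain ⟨E, hE⟩ : ∃ E, E = F 0 1 ^ 2 + F 0 2 ^ 2 + F 0 3 ^ 2 := ⟨_, rfl⟩
  have hBB : F 2 3 ^ 2 + F 3 1 ^ 2 + F 1 2 ^ 2 = E := by linarith
  have hEB : F 0 1 * F 2 3 + F 0 2 * F 3 1 + F 0 3 * F 1 2 = 0 := by linarith
  have hpos : 0 < E := by
    by_contra! hle
    have z1 : F 0 1 = 0 := by nlinarith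
    have z2 : F 0 2 = 0 := by nlinarith
    have z3 : F 0 3 = 0 := by nlinarith
    have y1 : F 2 3 = 0 := by nlinarith
    have y2 : F 3 1 = 0 := by nlinarith
    have y3 : F 1 2 = 0 := by nlinarith
    apply hne
    ext μ ν
    fin_cases μ <;> fin_cases ν <;>
      simp [hdiag, h10, h20, h30, h21, h32, h13, z1, z2, z3, y1, y2, y3]
  obtain ⟨n₁, hn₁⟩ : ∃ n, n = (F 0 2 * F 1 2 - F 0 3 * F 3 1) / E := ⟨_, rfl⟩
  obtain ⟨n₂, hn₂⟩ : ∃ n, n = (F 0 3 * F 2 3 - F 0 1 * F 1 2) / E := ⟨_, rfl⟩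
  obtain ⟨n₃, hn₃⟩ : ∃ n, n = (F 0 1 * F 3 1 - F 0 2 * F 2 3) / E := ⟨_, rfl⟩
  have hb₁ : F 2 3 = n₂ * F 0 3 - n₃ * F 0 2 := by
    rw [hn₂, hn₃]; field_simp; linear_combination F 2 3 * hE + F 0 1 * hEB
  have hb₂ : F 3 1 = n₃ * F 0 1 - n₁ * F 0 3 := by
    rw [hn₃, hn₁]; field_simp; linear_combination F 3 1 * hE + F 0 2 * hEB
  have hb₃ : F 1 2 = n₁ * F 0 2 - n₂ * F 0 1 := by
    rw [hn₁, hn₂]; field_simp; linear_combination F 1 2 * hE + F 0 3 * hEB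
  have hnn : n₁ ^ 2 + n₂ ^ 2 + n₃ ^ 2 = 1 := by
    rw [hn₁, hn₂, hn₃]; field_simp
    linear_combination (-(F 2 3 ^ 2 + F 3 1 ^ 2 + F 1 2 ^ 2)) * hE + E * hBB -
      (F 0 1 * F 2 3 + F 0 2 * F 3 1 + F 0 3 * F 1 2) * hEB
  have hne' : n₁ * F 0 1 + n₂ * F 0 2 + n₃ * F 0 3 = 0 := by
    rw [hn₁, hn₂, hn₃]; field_simp; ring
  have hll : etaB ![-1, n₁, n₂, n₃] ![-1, n₁, n₂, n₃] = 0 := by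
    simp [etaB_eq]; linear_combination hnn
  have hlw : etaB ![-1, n₁, n₂, n₃] ![0, F 0 1, F 0 2, F 0 3] = 0 := by
    simp [etaB_eq]; linear_combination hne'
  refine ⟨![-1, n₁, n₂, n₃], ![0, F 0 1, F 0 2, F 0 3], ?_, hll, ?_, hlw, ?_, ?_⟩
  · intro h
    simpa using congrFun h 0
  · simp [etaB_eq]; linarith
  · intro u v
    simp [etaB_eq, Fin.sum_univ_four, hdiag, h10, h20, h30, h21, h32, h13]
    linear_combination (u 2 * v 3 - u 3 * v 2) * hb₁ + (u 3 * v 1 - u 1 * v 3) * hb₂ +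
      (u 1 * v 2 - u 2 * v 1) * hb₃
  · intro μ
    fin_cases μ <;> simp [Fin.sum_univ_four, hdiag, h10, h20, h30, h21, h32, h13]
    · linear_combination hne'
    · linear_combination n₂ * hb₃ - n₃ * hb₂ - F 0 1 * hnn + n₁ * hne'
    · linear_combination n₃ * hb₁ - n₁ * hb₃ - F 0 2 * hnn + n₂ * hne'
    · linear_combination n₁ * hb₂ - n₂ * hb₁ - F 0 3 * hnn + n₃ * hne'
end
end

section
/- Pointwise staticity identity (equation (static1) of the paper): let (E, ⟨·,·⟩) be a real inner product space, N ∈ ℝ, Y, a ∈ E, K : E × E → ℝ a symmetric bilinear form and M : E × E → ℝ a bilinear form. Define f(u,v) = ½(M(u,v) − M(v,u)). Assume for all u, v, z ∈ E: (i) [Killing equation] 2N·K(u,v) + M(u,v) + M(v,u) = 0; (ii) [normal-tangential integrability] N·f(u,v) + ⟨Y,u⟩⟨a,v⟩ − ⟨Y,v⟩⟨a,u⟩ + ⟨Y,u⟩K(v,Y) − ⟨Y,v⟩K(u,Y) = 0; (iii) [tangential integrability] ⟨Y,u⟩f(v,z) + ⟨Y,v⟩f(z,u) + ⟨Y,z⟩f(u,v)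 = 0. Set λ = N² − ⟨Y,Y⟩ and dλ(v) = 2N⟨a,v⟩ − 2M(v,Y). Then λ·f(u,v) + ½(⟨Y,u⟩·dλ(v) − ⟨Y,v⟩·dλ(u)) = 0 for all u, v ∈ E. -/
noncomputable section
open RealInnerProductSpace

/-- Pointwise staticity identity: from the Killing equation and the two
integrability conditions one derives λ f(u,v) + ½(⟨Y,u⟩dλ(v) − ⟨Y,v⟩dλ(u)) = 0. -/
theorem staticity_identity
    {E : Type*} [NormedAddCommGroup E] [InnerProductSpace ℝ E]
    (N : ℝ) (Y a : E)
    (K M : E →ₗ[ℝ] E →ₗ[ℝ] ℝ)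
    (hKsym : ∀ u v : E, K u v = K v u)
    (f : E → E → ℝ)
    (hf : ∀ u v : E, f u v = (M u v - M v u) / 2)
    (hKilling : ∀ u v : E, 2 * N * K u v + M u v + M v u = 0)
    (hNormTang : ∀ u v : E,
      N * f u v + ⟪Y, u⟫ * ⟪a, v⟫ - ⟪Y, v⟫ * ⟪a, u⟫
        + ⟪Y, u⟫ * K v Y - ⟪Y, v⟫ * K u Y = 0)
    (hTang : ∀ u v z : E,
      ⟪Y, u⟫ * f v z + ⟪Y, v⟫ * f z u + ⟪Y, z⟫ * f u v = 0)
    (lam : ℝ) (hlam : lam = N ^ 2 - ⟪Y, Y⟫)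
    (dlam : E → ℝ) (hdlam : ∀ v : E, dlam v = 2 * N * ⟪a, v⟫ - 2 * M v Y) :
    ∀ u v : E, lam * f u v + (⟪Y, u⟫ * dlam v - ⟪Y, v⟫ * dlam u) / 2 = 0 := by
  intro u v
  have hT := hTang u v Y
  have hNT := hNormTang u v
  simp only [hf] at hT hNT
  simp only [hf, hlam, hdlam]
  linear_combination N * hNT - hT - ⟪Y, u⟫ / 2 * hKilling v Y + ⟪Y, v⟫ / 2 * hKilling u Y
end
end

section
/- Hessian of the norm-squared of a static Killing vector at a fixed point with null Killing form: let N : ℝ³ → ℝ and Y : ℝ³ → ℝ³ be twice continuously differentiable near 0 with N(0) = 0 and Y(0) = 0. Suppose there are a real number a ≠ 0 and vectors x, w ∈ ℝ³ with ‖x‖ = 1 and ⟨x,w⟩ = 0 such that the derivatives at 0 satisfy DN(0)(v) = a⟨w,v⟩ and DY(0)(v) = a(⟨x,v⟩·w − ⟨w,v⟩·x) for every v ∈ ℝ³. Define λ(p) = N(p)² − ‖Y(p)‖². Then for every v ∈ ℝ³, the second derivative of the function t ↦ λ(t·v) at t = 0 equals −2a²‖w‖²⟨x,v⟩²; in particular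 it is ≤ 0. -/
noncomputable section
open RealInnerProductSpace

/-- Restricting a map that is `Cⁿ` at the origin to a line through the origin. -/
theorem contDiffAt_comp_smul_const {E F : Type*} [NormedAddCommGroup E] [NormedSpace ℝ E]
    [NormedAddCommGroup F] [NormedSpace ℝ F] {n : WithTop ℕ∞} {f : E → F}
    (hf : ContDiffAt ℝ n f 0) (v : E) : ContDiffAt ℝ n (fun t : ℝ => f (t • v)) 0 :=
  ContDiffAt.comp (0 : ℝ) (g := f) (by simpa using hf) (by fun_prop)

/-- At a zero of a `C²` curve `f`, the second derivative of `‖f‖²` is `2 ‖f'‖²`. -/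
theorem iteratedDeriv_two_norm_sq_of_eq_zero {F : Type*} [NormedAddCommGroup F]
    [InnerProductSpace ℝ F] {f : ℝ → F} {t₀ : ℝ} (hf : ContDiffAt ℝ 2 f t₀) (h₀ : f t₀ = 0) :
    iteratedDeriv 2 (fun t => ‖f t‖ ^ 2) t₀ = 2 * ‖deriv f t₀‖ ^ 2 := by
  have hev : deriv (fun t => ‖f t‖ ^ 2) =ᶠ[nhds t₀] fun t => 2 * ⟪f t, deriv f t⟫ := by
    filter_upwards [hf.eventually (by simp)] with t ht
    exact (ht.differentiableAt (by simp)).hasDerivAt.norm_sq.deriv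
  have hf' : DifferentiableAt ℝ (deriv f) t₀ := by
    have h := (hf.fderiv_right (m := 1) (by norm_num)).differentiableAt (by simp)
    exact h.clm_apply (differentiableAt_const (1 : ℝ))
  have hmul := ((hf.differentiableAt (by simp)).hasDerivAt.inner ℝ hf'.hasDerivAt).const_mul 2
  rw [iteratedDeriv_succ, iteratedDeriv_one, hev.deriv_eq, hmul.deriv]
  simp [h₀]

/-- The restriction of a `C²` map vanishing at the origin to a line through the origin has
`2 ‖Df(0) v‖²` as second derivative of its squared norm. -/
theorem iteratedDeriv_two_norm_sq_comp_smul {E F : Type*} [NormedAddCommGroup E]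
    [NormedSpace ℝ E] [NormedAddCommGroup F] [InnerProductSpace ℝ F] {f : E → F}
    (hf : ContDiffAt ℝ 2 f 0) (h₀ : f 0 = 0) (v : E) :
    iteratedDeriv 2 (fun t : ℝ => ‖f (t • v)‖ ^ 2) 0 = 2 * ‖fderiv ℝ f 0 v‖ ^ 2 := by
  have hline : HasDerivAt (fun t : ℝ => t • v) v 0 := by
    simpa using (hasDerivAt_id (0 : ℝ)).smul_const v
  have hd : HasDerivAt (fun t : ℝ => f (t • v)) (fderiv ℝ f 0 v) 0 :=
    (hf.differentiableAt (by simp)).hasFDerivAt.comp_hasDerivAt_of_eq 0 hline (by simp)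
  rw [iteratedDeriv_two_norm_sq_of_eq_zero (contDiffAt_comp_smul_const hf v) (by simpa using h₀), hd.deriv]

/-- Hessian of λ = N² − ‖Y‖² along any direction at a fixed point where the
Killing form is null: the second derivative of t ↦ λ(t v) at 0 equals
−2a²‖w‖²⟨x,v⟩², which is ≤ 0. -/
theorem hessian_lambda_at_fixed_point
    (N : EuclideanSpace ℝ (Fin 3) → ℝ)
    (Y : EuclideanSpace ℝ (Fin 3) → EuclideanSpace ℝ (Fin 3))
    (hN : ContDiffAt ℝ 2 N 0) (hY : ContDiffAt ℝ 2 Y 0)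
    (hN0 : N 0 = 0) (hY0 : Y 0 = 0)
    (a : ℝ) (ha : a ≠ 0)
    (x w : EuclideanSpace ℝ (Fin 3))
    (hx : ‖x‖ = 1) (hxw : ⟪x, w⟫ = 0)
    (hDN : ∀ v, fderiv ℝ N 0 v = a * ⟪w, v⟫)
    (hDY : ∀ v, fderiv ℝ Y 0 v = a • (⟪x, v⟫ • w - ⟪w, v⟫ • x)) :
    ∀ v : EuclideanSpace ℝ (Fin 3),
      iteratedDeriv 2 (fun t : ℝ => (N (t • v)) ^ 2 - ‖Y (t • v)‖ ^ 2) 0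
        = -2 * a ^ 2 * ‖w‖ ^ 2 * ⟪x, v⟫ ^ 2 ∧
      iteratedDeriv 2 (fun t : ℝ => (N (t • v)) ^ 2 - ‖Y (t • v)‖ ^ 2) 0 ≤ 0 := by
  intro v
  have hsub : iteratedDeriv 2 (fun t : ℝ => (N (t • v)) ^ 2 - ‖Y (t • v)‖ ^ 2) 0
      = -2 * a ^ 2 * ‖w‖ ^ 2 * ⟪x, v⟫ ^ 2 := by
    have hNN := iteratedDeriv_two_norm_sq_comp_smul hN hN0 v
    simp only [Real.norm_eq_abs, sq_abs] at hNN
    rw [iteratedDeriv_fun_sub ((contDiffAt_comp_smul_const hN v).pow 2)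
      ((contDiffAt_comp_smul_const hY v).norm_sq ℝ), hNN,
      iteratedDeriv_two_norm_sq_comp_smul hY hY0 v, hDN, hDY, norm_smul, mul_pow, mul_pow,
      norm_sub_sq_real, norm_smul, norm_smul, real_inner_smul_left, real_inner_smul_right,
      real_inner_comm x w, hxw, hx]
    simp only [Real.norm_eq_abs, mul_pow, sq_abs]
    ring
  refine ⟨hsub, hsub.trans_le ?_⟩
  have : 0 ≤ a ^ 2 * ‖w‖ ^ 2 * ⟪x, v⟫ ^ 2 := by positivity
  linarith
end
end

section
/- Vanishing propagation for first-order differential inequalities: let U ⊆ ℝⁿ be open and connected, let u : U → ℝ^m be continuously differentiable, and suppose there is a constant C ≥ 0 such that the operator norm of the derivative satisfies ‖Du(x)‖ ≤ C·‖u(x)‖ for every x ∈ U. If u(x₀) = 0 for some x₀ ∈ U, then u(x) = 0 for every x ∈ U. -/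
/-- If the derivative of a map is bounded by a multiple of its norm along a segment and the map
vanishes at one endpoint of the segment, it vanishes at the other. -/
theorem eq_zero_of_norm_fderiv_le_mul_norm_on_segment
    {E F : Type*} [NormedAddCommGroup E] [NormedSpace ℝ E]
    [NormedAddCommGroup F] [NormedSpace ℝ F] {f : E → F} {C : ℝ} {x y : E}
    (hf : ∀ z ∈ segment ℝ x y, DifferentiableAt ℝ f z)
    (hbound : ∀ z ∈ segment ℝ x y, ‖fderiv ℝ f z‖ ≤ C * ‖f z‖) (hx : f x = 0) :
    f y = 0 := by
  have hmem : ∀ t ∈ Set.Icc (0 : ℝ) 1, AffineMap.lineMap x y t ∈ segment ℝ x y := fun t ht ↦ by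
    rw [segment_eq_image_lineMap]
    exact Set.mem_image_of_mem _ ht
  have hderiv : ∀ t ∈ Set.Icc (0 : ℝ) 1,
      HasDerivAt (fun s : ℝ ↦ f (AffineMap.lineMap x y s))
        (fderiv ℝ f (AffineMap.lineMap x y t) (y - x)) t := fun t ht ↦
    (hf _ (hmem t ht)).hasFDerivAt.comp_hasDerivAt t AffineMap.hasDerivAt_lineMap
  have hzero := eq_zero_of_abs_deriv_le_mul_abs_self_of_eq_zero_right (K := C * ‖y - x‖)
    (fun t ht ↦ (hderiv t ht).continuousAt.continuousWithinAt)
    (fun t ht ↦ (hderiv t (Set.Ico_subset_Icc_self ht)).hasDerivWithinAt)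
    (by simpa using hx)
    (fun t ht ↦ by
      calc ‖fderiv ℝ f (AffineMap.lineMap x y t) (y - x)‖
          ≤ ‖fderiv ℝ f (AffineMap.lineMap x y t)‖ * ‖y - x‖ := ContinuousLinearMap.le_opNorm _ _
        _ ≤ C * ‖f (AffineMap.lineMap x y t)‖ * ‖y - x‖ := by
          gcongr
          exact hbound _ (hmem t (Set.Ico_subset_Icc_self ht))
        _ = C * ‖y - x‖ * ‖f (AffineMap.lineMap x y t)‖ := by ring)
  simpa using hzero 1 (by simp)

/-- A differentiable map on a preconnected open set whose derivative is bounded by a multiple of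
its norm and which vanishes at one point vanishes identically. -/
theorem IsPreconnected.eqOn_zero_of_norm_fderiv_le_mul_norm
    {E F : Type*} [NormedAddCommGroup E] [NormedSpace ℝ E]
    [NormedAddCommGroup F] [NormedSpace ℝ F] {f : E → F} {C : ℝ} {U : Set E} {x₀ : E}
    (hU : IsPreconnected U) (hUo : IsOpen U) (hf : DifferentiableOn ℝ f U)
    (hbound : ∀ z ∈ U, ‖fderiv ℝ f z‖ ≤ C * ‖f z‖) (hx₀ : x₀ ∈ U) (h0 : f x₀ = 0) :
    Set.EqOn f 0 U := by
  have hdiff : ∀ z ∈ U, DifferentiableAt ℝ f z := fun z hz ↦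
    hf.differentiableAt (hUo.mem_nhds hz)
  have hlocal : ∀ x ∈ U, f x = 0 → x ∈ interior {z | f z = 0} := by
    intro x hx hfx
    obtain ⟨r, hr, hrU⟩ := Metric.isOpen_iff.mp hUo x hx
    refine mem_interior.mpr ⟨Metric.ball x r, fun y hy ↦ ?_, Metric.isOpen_ball,
      Metric.mem_ball_self hr⟩
    have hseg : segment ℝ x y ⊆ U :=
      ((convex_ball x r).segment_subset (Metric.mem_ball_self hr) hy).trans hrU
    exact eq_zero_of_norm_fderiv_le_mul_norm_on_segment (fun z hz ↦ hdiff z (hseg hz))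
      (fun z hz ↦ hbound z (hseg hz)) hfx
  have hsub : U ⊆ interior {z | f z = 0} := by
    refine hU.subset_of_closure_inter_subset isOpen_interior ⟨x₀, hx₀, hlocal x₀ hx₀ h0⟩ ?_
    rintro x ⟨hxcl, hxU⟩
    refine hlocal x hxU ?_
    have himage := (hdiff x hxU).continuousAt.continuousWithinAt.mem_closure (t := {0}) hxcl
      (fun z hz ↦ interior_subset (s := {z | f z = 0}) hz)
    simpa using himage
  exact fun x hx ↦ interior_subset (s := {z | f z = 0}) (hsub hx)

/-- Vanishing propagation: a C¹ map on an open connected set whose derivative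
is bounded by a constant times its norm, and which vanishes at one point,
vanishes identically. -/
theorem vanishing_propagation
    {n m : ℕ}
    (U : Set (EuclideanSpace ℝ (Fin n)))
    (hUopen : IsOpen U) (hUconn : IsConnected U)
    (u : EuclideanSpace ℝ (Fin n) → EuclideanSpace ℝ (Fin m))
    (hu : ContDiffOn ℝ 1 u U)
    (C : ℝ) (hC : 0 ≤ C)
    (hbound : ∀ x ∈ U, ‖fderivWithin ℝ u U x‖ ≤ C * ‖u x‖)
    (x₀ : EuclideanSpace ℝ (Fin n)) (hx₀ : x₀ ∈ U) (hu0 : u x₀ = 0) :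
    ∀ x ∈ U, u x = 0 := by
  refine hUconn.isPreconnected.eqOn_zero_of_norm_fderiv_le_mul_norm (C := C) hUopen
    (hu.differentiableOn one_ne_zero) (fun z hz ↦ ?_) hx₀ hu0
  rw [← fderivWithin_of_isOpen hUopen hz]
  exact hbound z hz
end

section
/- Flat-space version of the paper's Lemma 1 (vanishing of a KID with vanishing Killing form at a fixed point): let U ⊆ ℝ³ be open and connected, let K_{ij} be a continuously differentiable symmetric-matrix-valued function and Q_{ij} a continuous symmetric-matrix-valued function on U. Suppose N : U → ℝ is twice continuously differentiable, Y : U → ℝ³ and the antisymmetric-matrix-valued f_{ij} : U → ℝ^{3×3} are continuously differentiable, and that on all of U they satisfy the system: ∂_i Y_j = −N K_{ij} + f_{ij}; ∂_i ∂_j N = N Q_{ij} − Σ_l Y_l ∂_l K_{ij} − Σ_l K_{il} f_{jl} − Σ_l K_{jl} f_{il}; and ∂_l f_{ij} = (∂_j N) K_{li} − (∂_i N) K_{lj} + N ∂_j K_{li} − N ∂_i K_{lj}. If at some point p ∈ U one has N(p) = 0, ∂_iN(p) = 0 for all i, Y(p) = 0 and f_{ij}(p) = 0, then N ≡ 0,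 Y ≡ 0 and f ≡ 0 on all of U. -/
noncomputable section

/-- The i-th partial derivative (within U) of a scalar function on ℝ³. -/
def pd (U : Set (EuclideanSpace ℝ (Fin 3))) (g : EuclideanSpace ℝ (Fin 3) → ℝ)
    (i : Fin 3) (x : EuclideanSpace ℝ (Fin 3)) : ℝ :=
  fderivWithin ℝ g U x (EuclideanSpace.single i (1 : ℝ))

open Asymptotics Topology Set

/-- Unique continuation: if the derivative of `u` is locally dominated by `u` on an open
preconnected set and `u` vanishes at one point, then `u` vanishes identically. -/
theorem eqOn_zero_of_fderivWithin_isBigO {E F : Type*} [NormedAddCommGroup E] [NormedSpace ℝ E]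
    [NormedAddCommGroup F] [NormedSpace ℝ F] {U : Set E} {u : E → F} {p : E}
    (hU : IsOpen U) (hc : IsPreconnected U) (hd : DifferentiableOn ℝ u U)
    (hb : ∀ x ∈ U, fderivWithin ℝ u U =O[𝓝 x] u) (hp : p ∈ U) (hup : u p = 0) :
    ∀ x ∈ U, u x = 0 := by
  suffices h : U ⊆ {x | ∀ᶠ y in 𝓝 x, u y = 0} from fun x hx => (h hx).self_of_nhds
  have key : ∀ x ∈ U, ∃ V ∈ 𝓝 x, ∀ y ∈ V, u y = 0 → ∀ z ∈ V, u z = 0 := by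
    intro x hx
    obtain ⟨C, hC⟩ := (hb x hx).bound
    obtain ⟨r, hr, hball⟩ := Metric.eventually_nhds_iff_ball.1 (hC.and (hU.mem_nhds hx))
    refine ⟨Metric.ball x r, Metric.ball_mem_nhds x hr, fun y hy huy z hz => ?_⟩
    have hseg : ∀ t ∈ Icc (0 : ℝ) 1, y + t • (z - y) ∈ Metric.ball x r :=
      fun t ht => (convex_ball x r).add_smul_sub_mem hy hz ht
    have hderiv : ∀ t ∈ Icc (0 : ℝ) 1, HasDerivAt (fun t : ℝ => u (y + t • (z - y)))
        (fderivWithin ℝ u U (y + t • (z - y)) (z - y)) t := by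
      intro t ht
      have hmem : y + t • (z - y) ∈ U := (hball _ (hseg t ht)).2
      have hu := (hd _ hmem).hasFDerivWithinAt.hasFDerivAt (hU.mem_nhds hmem)
      have hline : HasDerivAt (fun t : ℝ => y + t • (z - y)) (z - y) t := by
        simpa using ((hasDerivAt_id t).smul_const (z - y)).const_add y
      exact hu.comp_hasDerivAt t hline
    have hz0 := eq_zero_of_abs_deriv_le_mul_abs_self_of_eq_zero_right
      (f := fun t : ℝ => u (y + t • (z - y))) (K := C * ‖z - y‖) (a := 0) (b := 1)
      (fun t ht => (hderiv t ht).continuousAt.continuousWithinAt)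
      (fun t ht => (hderiv t (Ico_subset_Icc_self ht)).hasDerivWithinAt) (by simpa using huy)
      (fun t ht => by
        refine (ContinuousLinearMap.le_opNorm _ _).trans ?_
        have := (hball _ (hseg t (Ico_subset_Icc_self ht))).1
        calc _ ≤ C * ‖u (y + t • (z - y))‖ * ‖z - y‖ := by gcongr
          _ = _ := by ring)
      1 (by simp)
    simpa using hz0
  refine hc.subset_of_closure_inter_subset isOpen_setOfPred_eventually_nhds ⟨p, hp, ?_⟩ ?_
  · obtain ⟨V, hV, h⟩ := key p hp
    filter_upwards [hV] with z hz using h p (mem_of_mem_nhds hV) hup z hz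
  · rintro x ⟨hxc, hx⟩
    obtain ⟨V, hV, h⟩ := key x hx
    obtain ⟨y, hyV, hy⟩ := mem_closure_iff_nhds.1 hxc V hV
    filter_upwards [hV] with z hz using h y hyV hy.self_of_nhds z hz

/-- Unique continuation for a finite family of functions on `ℝ³` whose partial derivatives are
locally dominated by the family. -/
theorem eq_zero_of_pd_isBigO {ι : Type*} [Fintype ι] {U : Set (EuclideanSpace ℝ (Fin 3))}
    {u : EuclideanSpace ℝ (Fin 3) → ι → ℝ} {p : EuclideanSpace ℝ (Fin 3)}
    (hU : IsOpen U) (hc : IsPreconnected U)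
    (hd : ∀ a, DifferentiableOn ℝ (fun x => u x a) U)
    (hb : ∀ x ∈ U, ∀ a i, pd U (fun y => u y a) i =O[𝓝 x] u) (hp : p ∈ U) (hup : u p = 0) :
    ∀ x ∈ U, u x = 0 := by
  have hdu : DifferentiableOn ℝ u U := differentiableOn_pi.2 hd
  refine eqOn_zero_of_fderivWithin_isBigO hU hc hdu (fun x hx => ?_) hp hup
  have hcoord : ∀ i, (fun y => fderivWithin ℝ u U y (EuclideanSpace.single i (1 : ℝ)))
      =O[𝓝 x] u := by
    refine fun i => isBigO_pi.2 fun a => (hb x hx a i).congr' ?_ .rfl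
    filter_upwards [hU.mem_nhds hx] with y hy
    rw [fderivWithin_pi (fun a => hd a y hy) (hU.uniqueDiffWithinAt hy)]
    rfl
  have hsum : fderivWithin ℝ u U = fun y => ∑ i : Fin 3,
      (EuclideanSpace.proj i : EuclideanSpace ℝ (Fin 3) →L[ℝ] ℝ).smulRight
        (fderivWithin ℝ u U y (EuclideanSpace.single i (1 : ℝ))) := by
    funext y
    refine ContinuousLinearMap.coe_injective
      ((EuclideanSpace.basisFun (Fin 3) ℝ).toBasis.ext fun j => ?_)
    simp
  rw [hsum]
  refine IsBigO.fun_sum fun i _ => ?_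
  refine IsBigO.trans ?_ (hcoord i)
  refine IsBigO.of_bound ‖(EuclideanSpace.proj i : EuclideanSpace ℝ (Fin 3) →L[ℝ] ℝ)‖
    (.of_forall fun y => ?_)
  rw [ContinuousLinearMap.norm_smulRight_apply]

/-- Flat-space version of the vanishing lemma for Killing initial data: if N, Y
and the antisymmetric f satisfy the first-order system obtained from the KID
equations and all vanish (together with DN) at one point of an open connected
set U, then they vanish identically on U. -/
theorem KID_vanishing_flat
    (U : Set (EuclideanSpace ℝ (Fin 3)))
    (hUopen : IsOpen U) (hUconn : IsConnected U)
    (K Q : EuclideanSpace ℝ (Fin 3) → Matrix (Fin 3) (Fin 3) ℝ)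
    (N : EuclideanSpace ℝ (Fin 3) → ℝ)
    (Y : EuclideanSpace ℝ (Fin 3) → (Fin 3 → ℝ))
    (f : EuclideanSpace ℝ (Fin 3) → Matrix (Fin 3) (Fin 3) ℝ)
    (hKsym : ∀ x ∈ U, ∀ i j, K x i j = K x j i)
    (hKreg : ∀ i j, ContDiffOn ℝ 1 (fun x => K x i j) U)
    (hQsym : ∀ x ∈ U, ∀ i j, Q x i j = Q x j i)
    (hQcont : ∀ i j, ContinuousOn (fun x => Q x i j) U)
    (hNreg : ContDiffOn ℝ 2 N U)
    (hYreg : ∀ j, ContDiffOn ℝ 1 (fun x => Y x j) U)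
    (hfanti : ∀ x ∈ U, ∀ i j, f x i j = - f x j i)
    (hfreg : ∀ i j, ContDiffOn ℝ 1 (fun x => f x i j) U)
    (heq1 : ∀ x ∈ U, ∀ i j,
      pd U (fun y => Y y j) i x = - N x * K x i j + f x i j)
    (heq2 : ∀ x ∈ U, ∀ i j,
      pd U (fun y => pd U N j y) i x
        = N x * Q x i j
          - (∑ l, Y x l * pd U (fun y => K y i j) l x)
          - (∑ l, K x i l * f x j l)
          - (∑ l, K x j l * f x i l))
    (heq3 : ∀ x ∈ U, ∀ l i j,
      pd U (fun y => f y i j) l x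
        = pd U N j x * K x l i - pd U N i x * K x l j
          + N x * pd U (fun y => K y l i) j x
          - N x * pd U (fun y => K y l j) i x)
    (p : EuclideanSpace ℝ (Fin 3)) (hp : p ∈ U)
    (hNp : N p = 0) (hdNp : ∀ i, pd U N i p = 0)
    (hYp : Y p = 0) (hfp : f p = 0) :
    ∀ x ∈ U, N x = 0 ∧ Y x = 0 ∧ f x = 0 := by
  let u : EuclideanSpace ℝ (Fin 3) → (Unit ⊕ Fin 3) ⊕ (Fin 3 ⊕ Fin 3 × Fin 3) → ℝ := fun x =>
    Sum.elim (Sum.elim (fun _ => N x) (fun j => pd U N j x))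
      (Sum.elim (fun j => Y x j) (fun ij => f x ij.1 ij.2))
  have hpdN : ∀ j, ContDiffOn ℝ 1 (pd U N j) U := fun j =>
    (hNreg.fderivWithin hUopen.uniqueDiffOn (by norm_num)).clm_apply contDiffOn_const
  have hu : ∀ x ∈ U, u x = 0 := by
    refine eq_zero_of_pd_isBigO hUopen hUconn.isPreconnected ?_ ?_ hp ?_
    · rintro ((_ | j) | (j | ⟨i, j⟩))
      · exact hNreg.differentiableOn (by norm_num)
      · exact (hpdN j).differentiableOn (by norm_num)
      · exact (hYreg j).differentiableOn (by norm_num)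
      · exact (hfreg i j).differentiableOn (by norm_num)
    · intro x hx
      have hcomp : ∀ a, (fun y => u y a) =O[𝓝 x] u := fun a => isBigO_pi.1 (isBigO_refl u _) a
      have hN : N =O[𝓝 x] u := hcomp (.inl (.inl ()))
      have hdN : ∀ j, pd U N j =O[𝓝 x] u := fun j => hcomp (.inl (.inr j))
      have hY : ∀ j, (fun y => Y y j) =O[𝓝 x] u := fun j => hcomp (.inr (.inl j))
      have hf : ∀ i j, (fun y => f y i j) =O[𝓝 x] u := fun i j => hcomp (.inr (.inr (i, j)))
      have hbdd : ∀ {g : EuclideanSpace ℝ (Fin 3) → ℝ}, ContinuousOn g U →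
          g =O[𝓝 x] fun _ => (1 : ℝ) :=
        fun hg => (hg.continuousAt (hUopen.mem_nhds hx)).isBigO_one ℝ
      have hK : ∀ i j, (fun y => K y i j) =O[𝓝 x] fun _ => (1 : ℝ) :=
        fun i j => hbdd (hKreg i j).continuousOn
      have hdK : ∀ i j l, pd U (fun y => K y i j) l =O[𝓝 x] fun _ => (1 : ℝ) := fun i j l =>
        hbdd (((hKreg i j).continuousOn_fderivWithin hUopen.uniqueDiffOn le_rfl).clm_apply
          continuousOn_const)
      have hmul : ∀ {g h : EuclideanSpace ℝ (Fin 3) → ℝ}, g =O[𝓝 x] u →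
          h =O[𝓝 x] (fun _ => (1 : ℝ)) → (fun y => g y * h y) =O[𝓝 x] u :=
        fun hg hh => by simpa using (hg.norm_right.mul hh).norm_right
      have hmul' : ∀ {g h : EuclideanSpace ℝ (Fin 3) → ℝ}, g =O[𝓝 x] (fun _ => (1 : ℝ)) →
          h =O[𝓝 x] u → (fun y => g y * h y) =O[𝓝 x] u :=
        fun hg hh => by simpa using (hg.mul hh.norm_right).norm_right
      have hcongr : ∀ {g h : EuclideanSpace ℝ (Fin 3) → ℝ}, (∀ y ∈ U, g y = h y) →
          h =O[𝓝 x] u → g =O[𝓝 x] u := fun hgh hh =>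
        hh.congr' (Filter.eventually_of_mem (hUopen.mem_nhds hx) fun y hy => (hgh y hy).symm) .rfl
      rintro ((_ | j) | (j | ⟨i, j⟩)) l
      · exact hdN l
      · exact hcongr (fun y hy => heq2 y hy l j)
          ((((hmul hN (hbdd (hQcont l j))).sub
            (IsBigO.fun_sum fun m _ => hmul (hY m) (hdK l j m))).sub
            (IsBigO.fun_sum fun m _ => hmul' (hK l m) (hf j m))).sub
            (IsBigO.fun_sum fun m _ => hmul' (hK j m) (hf l m)))
      · exact hcongr (fun y hy => heq1 y hy l j) ((hmul hN.neg_left (hK l j)).add (hf l j))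
      · exact hcongr (fun y hy => heq3 y hy l i j)
          ((((hmul (hdN j) (hK l i)).sub (hmul (hdN i) (hK l j))).add
            (hmul hN (hdK l i j))).sub (hmul hN (hdK l j i)))
    · funext a
      rcases a with (_ | j) | (j | ⟨i, j⟩)
      · exact hNp
      · exact hdNp j
      · exact congrFun hYp j
      · exact congrFun (congrFun hfp i) j
  intro x hx
  exact ⟨congrFun (hu x hx) (.inl (.inl ())), funext fun j => congrFun (hu x hx) (.inr (.inl j)),
    funext fun i => funext fun j => congrFun (hu x hx) (.inr (.inr (i, j)))⟩
end
end
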